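/- arXiv:2308.11634 — 5 statements merged into one kernel-verified Lean document; each statement's English description precedes it below -/
import Mathlib

section
/- Define Φ : (0,1)² → ℝ², Φ(a,b) = ((b − a·b)/(1 − a·b), a·b), and Ψ : (0,1)² → ℝ², Ψ(c,d) = (d/(c + d − c·d), c + d − c·d). Then Φ and Ψ map (0,1)² into (0,1)², and they are mutually inverse: Ψ(Φ(a,b)) = (a,b) for all a,b ∈ (0,1), and Φ(Ψ(c,d)) = (c,d) for all c,d ∈ (0,1). -/
/-- `Φ(a,b) = ((b − a·b)/(1 − a·b), a·b)`. -/
noncomputable def PhiMap : ℝ × ℝ → ℝ × ℝ :=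
  fun p => ((p.2 - p.1 * p.2) / (1 - p.1 * p.2), p.1 * p.2)

/-- `Ψ(c,d) = (d/(c + d − c·d), c + d − c·d)`. -/
noncomputable def PsiMap : ℝ × ℝ → ℝ × ℝ :=
  fun p => (p.2 / (p.1 + p.2 - p.1 * p.2), p.1 + p.2 - p.1 * p.2)

/-- `Φ` and `Ψ` map `(0,1)²` into `(0,1)²` and are mutually inverse there. -/
theorem PhiMap_PsiMap_inverse :
    (∀ a b : ℝ, a ∈ Set.Ioo (0:ℝ) 1 → b ∈ Set.Ioo (0:ℝ) 1 →
      PhiMap (a, b) ∈ Set.Ioo (0:ℝ) 1 ×ˢ Set.Ioo (0:ℝ) 1) ∧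
    (∀ c d : ℝ, c ∈ Set.Ioo (0:ℝ) 1 → d ∈ Set.Ioo (0:ℝ) 1 →
      PsiMap (c, d) ∈ Set.Ioo (0:ℝ) 1 ×ˢ Set.Ioo (0:ℝ) 1) ∧
    (∀ a b : ℝ, a ∈ Set.Ioo (0:ℝ) 1 → b ∈ Set.Ioo (0:ℝ) 1 →
      PsiMap (PhiMap (a, b)) = (a, b)) ∧
    (∀ c d : ℝ, c ∈ Set.Ioo (0:ℝ) 1 → d ∈ Set.Ioo (0:ℝ) 1 →
      PhiMap (PsiMap (c, d)) = (c, d)) := by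
  refine ⟨?_, ?_, ?_, ?_⟩
  · rintro a b ⟨ha0, ha1⟩ ⟨hb0, hb1⟩
    have hab : 0 < a * b := mul_pos ha0 hb0
    have hab_lt : a * b < b := mul_lt_of_lt_one_left hb0 ha1
    have hden : 0 < 1 - a * b := by linarith
    refine ⟨⟨div_pos (by linarith) hden, ?_⟩, hab, hab_lt.trans hb1⟩
    exact (div_lt_one hden).2 (by linarith)
  · rintro c d ⟨hc0, hc1⟩ ⟨hd0, hd1⟩
    have hcd : 0 < c * (1 - d) := mul_pos hc0 (by linarith)
    have hcd' : 0 < (1 - c) * (1 - d) := mul_pos (by linarith) (by linarith)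
    have hden : 0 < c + d - c * d := by linarith
    refine ⟨⟨div_pos hd0 hden, ?_⟩, hden, ?_⟩
    · exact (div_lt_one hden).2 (by linarith)
    · change c + d - c * d < 1
      linarith
  · rintro a b ⟨ha0, ha1⟩ ⟨hb0, hb1⟩
    have hden : 1 - a * b ≠ 0 := by
      have : a * b < b := mul_lt_of_lt_one_left hb0 ha1
      exact ne_of_gt (by linarith)
    have hdual : (b - a * b) / (1 - a * b) + a * b
        - (b - a * b) / (1 - a * b) * (a * b) = b := by
      linear_combination div_mul_cancel₀ (b - a * b) hden
    simp only [PhiMap, PsiMap, hdual, mul_div_cancel_right₀ a hb0.ne']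
  · rintro c d ⟨hc0, hc1⟩ ⟨hd0, hd1⟩
    have hden : c + d - c * d ≠ 0 := by
      have : 0 < c * (1 - d) := mul_pos hc0 (by linarith)
      exact ne_of_gt (by linarith)
    have hd : 1 - d ≠ 0 := ne_of_gt (by linarith)
    have hquot : (c + d - c * d - d) / (1 - d) = c :=
      (div_eq_iff hd).2 (by ring)
    simp only [PhiMap, PsiMap, div_mul_cancel₀ d hden, hquot]
end

section
/- Let A be a type equipped with a family of binary operations M p : A → A → A indexed by real numbers p ∈ (0,1), satisfying idempotence (M p x x = x), skew-commutativity (M p x y = M (1−p) y x), and skew-associativity (M q (M p x y) z = M (p+q−p·q) x (M (q/(p+q−p·q)) y z) for all p, q ∈ (0,1)). Then A satisfies the entropic property: for all s, t, u, v ∈ A and all p, q ∈ (0,1), M q (M p s t) (M p u v) = M p (M q s u) (M q t v). -/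
/-- In a nested mean, the first two points can be exchanged once the weights are adjusted. -/
theorem barycentric_left_comm {A : Type*} (M : ℝ → A → A → A)
    (hsc : ∀ p ∈ Set.Ioo (0:ℝ) 1, ∀ x y : A, M p x y = M (1 - p) y x)
    (hsa : ∀ p ∈ Set.Ioo (0:ℝ) 1, ∀ q ∈ Set.Ioo (0:ℝ) 1, ∀ x y z : A,
      M q (M p x y) z = M (p + q - p * q) x (M (q / (p + q - p * q)) y z))
    {a b a' b' : ℝ} (ha : a ∈ Set.Ioo (0:ℝ) 1) (hb : b ∈ Set.Ioo (0:ℝ) 1)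
    (ha' : a' = 1 - a * (1 - b)) (hb' : a' * b' = a * b) (x y z : A) :
    M a x (M b y z) = M a' y (M b' x z) := by
  obtain ⟨ha0, ha1⟩ := ha
  obtain ⟨hb0, hb1⟩ := hb
  have hab0 : 0 < a * b := mul_pos ha0 hb0
  have hab1 : a * b < 1 := by nlinarith
  have hab : 1 - a * b ≠ 0 := by linarith
  have ha'0 : 0 < a' := by rw [ha']; nlinarith
  have hp : (a - a * b) / (1 - a * b) ∈ Set.Ioo (0:ℝ) 1 := by
    constructor
    · exact div_pos (by nlinarith) (by linarith)
    · rw [div_lt_one (by linarith)]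
      linarith
  have hp' : 1 - (a - a * b) / (1 - a * b) ∈ Set.Ioo (0:ℝ) 1 :=
    ⟨by linarith [hp.2], by linarith [hp.1]⟩
  have h₁ := hsa _ hp _ ⟨hab0, hab1⟩ x y z
  have h₂ := hsa _ hp' _ ⟨hab0, hab1⟩ y x z
  have e₁ : (a - a * b) / (1 - a * b) + a * b - (a - a * b) / (1 - a * b) * (a * b) = a := by
    field_simp
    ring
  have e₂ : 1 - (a - a * b) / (1 - a * b) + a * b
      - (1 - (a - a * b) / (1 - a * b)) * (a * b) = a' := by
    rw [ha']
    field_simp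
    ring
  rw [e₁, mul_div_cancel_left₀ b ha0.ne'] at h₁
  rw [e₂, ← hb', mul_div_cancel_left₀ b' ha'0.ne', hb'] at h₂
  rw [← h₁, hsc _ hp, h₂]

/-- Every abstract barycentric algebra satisfies the entropic property. -/
theorem barycentric_entropic {A : Type*} (M : ℝ → A → A → A)
    (hid : ∀ p ∈ Set.Ioo (0:ℝ) 1, ∀ x : A, M p x x = x)
    (hsc : ∀ p ∈ Set.Ioo (0:ℝ) 1, ∀ x y : A, M p x y = M (1 - p) y x)
    (hsa : ∀ p ∈ Set.Ioo (0:ℝ) 1, ∀ q ∈ Set.Ioo (0:ℝ) 1, ∀ x y z : A,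
      M q (M p x y) z = M (p + q - p * q) x (M (q / (p + q - p * q)) y z)) :
    ∀ s t u v : A, ∀ p ∈ Set.Ioo (0:ℝ) 1, ∀ q ∈ Set.Ioo (0:ℝ) 1,
      M q (M p s t) (M p u v) = M p (M q s u) (M q t v) := by
  intro s t u v p hp q hq
  have hr : q < p + q - p * q := by nlinarith [hp.1, hq.2]
  have hr0 : 0 < p + q - p * q := hq.1.trans hr
  have hqr : q / (p + q - p * q) ∈ Set.Ioo (0:ℝ) 1 :=
    ⟨div_pos hq.1 hr0, (div_lt_one hr0).2 hr⟩
  rw [hsa p hp q hq, hsa q hq p hp, add_comm q p, mul_comm q p]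
  congr 1
  apply barycentric_left_comm M hsc hsa hqr hp
  · field_simp
    ring
  · ring
end

section
/- Let A and A' be abstract barycentric algebras, with operations M p on A and M' p on A' (each satisfying idempotence, skew-commutativity, and skew-associativity). Let f, g : A → A' be barycentric homomorphisms, i.e. f(M p x y) = M' p (f x) (f y) and g(M p x y) = M' p (g x) (g y) for all p ∈ (0,1) and x, y ∈ A. Then for every p ∈ (0,1) the pointwise combination h : A → A' defined by h(x) = M' p (f x) (g x) is again a barycentric homomorphism: h(M q x y) = M' q (h x) (h y) for all q ∈ (0,1) and x, y ∈ A. -/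
/-- Exchanging the two outer points of a nested barycentric combination. -/
theorem barycentric_left_comm_s6 {A : Type*} (M : ℝ → A → A → A)
    (hsc : ∀ p ∈ Set.Ioo (0:ℝ) 1, ∀ x y : A, M p x y = M (1 - p) y x)
    (hsa : ∀ p ∈ Set.Ioo (0:ℝ) 1, ∀ q ∈ Set.Ioo (0:ℝ) 1, ∀ x y z : A,
      M q (M p x y) z = M (p + q - p * q) x (M (q / (p + q - p * q)) y z))
    {p q : ℝ} (hp : p ∈ Set.Ioo (0:ℝ) 1) (hq : q ∈ Set.Ioo (0:ℝ) 1) (b c d : A) :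
    M (p / (p + q - p * q)) b (M q c d) = M (q / (p + q - p * q)) c (M p b d) := by
  have regroup : ∀ p ∈ Set.Ioo (0:ℝ) 1, ∀ q ∈ Set.Ioo (0:ℝ) 1, ∀ b c : A,
      p * (1 - q) / (p * (1 - q) + q * (1 - p)) ∈ Set.Ioo (0:ℝ) 1 ∧
      M (p / (p + q - p * q)) b (M q c d) =
        M (p * q / (p + q - p * q))
          (M (p * (1 - q) / (p * (1 - q) + q * (1 - p))) b c) d := by
    rintro p ⟨hp0, hp1⟩ q ⟨hq0, hq1⟩ b c
    have hpq : 0 < p * (1 - q) := mul_pos hp0 (sub_pos.2 hq1)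
    have hqp : 0 < q * (1 - p) := mul_pos hq0 (sub_pos.2 hp1)
    have hmul : 0 < p * q := mul_pos hp0 hq0
    have hr : 0 < p + q - p * q := by linarith
    have hs : 0 < p * (1 - q) + q * (1 - p) := by linarith
    have hP : p * (1 - q) / (p * (1 - q) + q * (1 - p)) ∈ Set.Ioo (0:ℝ) 1 :=
      ⟨div_pos hpq hs, (div_lt_one hs).2 (by linarith)⟩
    have hQ : p * q / (p + q - p * q) ∈ Set.Ioo (0:ℝ) 1 :=
      ⟨div_pos hmul hr, (div_lt_one hr).2 (by linarith)⟩
    refine ⟨hP, ?_⟩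
    have outer : p * (1 - q) / (p * (1 - q) + q * (1 - p)) + p * q / (p + q - p * q)
        - p * (1 - q) / (p * (1 - q) + q * (1 - p)) * (p * q / (p + q - p * q))
        = p / (p + q - p * q) := by
      have hr' := hr.ne'
      have hs' := hs.ne'
      field_simp
      ring
    have inner : p * q / (p + q - p * q) / (p / (p + q - p * q)) = q := by
      have hr' := hr.ne'
      field_simp
    rw [hsa _ hP _ hQ, outer, inner]
  obtain ⟨hP, h⟩ := regroup p hp q hq b c
  obtain ⟨-, h'⟩ := regroup q hq p hp c b
  have hs : p * (1 - q) + q * (1 - p) ≠ 0 := by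
    intro h0
    simp [h0] at hP
  have compl : 1 - p * (1 - q) / (p * (1 - q) + q * (1 - p))
      = q * (1 - p) / (q * (1 - p) + p * (1 - q)) := by
    rw [add_comm (q * (1 - p)), eq_div_iff hs, sub_mul, div_mul_cancel₀ _ hs]
    ring
  rw [h, hsc _ hP, compl, mul_comm p q, add_comm p q, h']

/-- The entropic property of abstract barycentric algebras. -/
theorem barycentric_entropic_s6 {A : Type*} (M : ℝ → A → A → A)
    (hsc : ∀ p ∈ Set.Ioo (0:ℝ) 1, ∀ x y : A, M p x y = M (1 - p) y x)
    (hsa : ∀ p ∈ Set.Ioo (0:ℝ) 1, ∀ q ∈ Set.Ioo (0:ℝ) 1, ∀ x y z : A,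
      M q (M p x y) z = M (p + q - p * q) x (M (q / (p + q - p * q)) y z))
    {p q : ℝ} (hp : p ∈ Set.Ioo (0:ℝ) 1) (hq : q ∈ Set.Ioo (0:ℝ) 1) (a b c d : A) :
    M p (M q a b) (M q c d) = M q (M p a c) (M p b d) := by
  rw [hsa q hq p hp, hsa p hp q hq, add_comm q p, mul_comm q p,
    barycentric_left_comm_s6 M hsc hsa hp hq]


/-- The pointwise barycentric combination of two barycentric homomorphisms
is again a barycentric homomorphism. -/
theorem pointwise_combination_hom {A A' : Type*}
    (M : ℝ → A → A → A) (M' : ℝ → A' → A' → A')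
    (hid : ∀ p ∈ Set.Ioo (0:ℝ) 1, ∀ x : A, M p x x = x)
    (hsc : ∀ p ∈ Set.Ioo (0:ℝ) 1, ∀ x y : A, M p x y = M (1 - p) y x)
    (hsa : ∀ p ∈ Set.Ioo (0:ℝ) 1, ∀ q ∈ Set.Ioo (0:ℝ) 1, ∀ x y z : A,
      M q (M p x y) z = M (p + q - p * q) x (M (q / (p + q - p * q)) y z))
    (hid' : ∀ p ∈ Set.Ioo (0:ℝ) 1, ∀ x : A', M' p x x = x)
    (hsc' : ∀ p ∈ Set.Ioo (0:ℝ) 1, ∀ x y : A', M' p x y = M' (1 - p) y x)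
    (hsa' : ∀ p ∈ Set.Ioo (0:ℝ) 1, ∀ q ∈ Set.Ioo (0:ℝ) 1, ∀ x y z : A',
      M' q (M' p x y) z = M' (p + q - p * q) x (M' (q / (p + q - p * q)) y z))
    (f g : A → A')
    (hf : ∀ p ∈ Set.Ioo (0:ℝ) 1, ∀ x y : A, f (M p x y) = M' p (f x) (f y))
    (hg : ∀ p ∈ Set.Ioo (0:ℝ) 1, ∀ x y : A, g (M p x y) = M' p (g x) (g y))
    (p : ℝ) (hp : p ∈ Set.Ioo (0:ℝ) 1) :
    ∀ q ∈ Set.Ioo (0:ℝ) 1, ∀ x y : A,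
      (fun a => M' p (f a) (g a)) (M q x y)
        = M' q ((fun a => M' p (f a) (g a)) x) ((fun a => M' p (f a) (g a)) y) := by
  intro q hq x y
  simp only [hf q hq, hg q hq]
  exact barycentric_entropic_s6 M' hsc' hsa' hp hq _ _ _ _
end

section
/- Let n ≥ 3, let v : ZMod n → ℝ² (the vertices of a polygon, indexed cyclically), and let x ∈ ℝ². For each i set A_i := A(x, v i, v (i+1)) and B_i := A(v (i−1), v i, v (i+1)), where A denotes signed area. Assume A_i > 0 and B_i > 0 for all i (x is an interior point of the convex polygon with counterclockwise-ordered vertices). Define the Wachspress weights w_i := B_i / (A_{i−1} · A_i). Then ∑_i w_i > 0 and (∑_i w_i) • x = ∑_i w_i • v i; equivalently, x = (∑_j w_j)⁻¹ • ∑_i w_i • v i is a convex combination of the vertices. -/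
/-- Signed area of the triangle `v₀ v₁ v₂` in the plane `ℝ × ℝ`. -/
noncomputable def signedArea (v₀ v₁ v₂ : ℝ × ℝ) : ℝ :=
  (1 / 2) * ((v₁.1 - v₀.1) * (v₂.2 - v₀.2) - (v₁.2 - v₀.2) * (v₂.1 - v₀.1))

/-- The Wachspress-weighted offset of a vertex `q` from `x` is the difference of the two incident
edge vectors, each divided by the area of the triangle it spans with `x`. -/
theorem wachspress_weight_smul_sub (x p q r : ℝ × ℝ) (hpq : signedArea x p q ≠ 0)
    (hqr : signedArea x q r ≠ 0) :
    (signedArea p q r / (signedArea x p q * signedArea x q r)) • (q - x)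
      = (signedArea x p q)⁻¹ • (q - p) - (signedArea x q r)⁻¹ • (r - q) := by
  have key : signedArea p q r • (q - x)
      = signedArea x q r • (q - p) - signedArea x p q • (r - q) := by
    ext <;> simp [signedArea] <;> ring
  rw [div_eq_inv_mul, mul_smul, key, smul_sub, smul_smul, smul_smul]
  congr 2 <;> field_simp

/-- An interior point of a convex polygon is the convex combination of the
vertices given by the Wachspress weights `w_i = B_i / (A_{i-1} A_i)`. -/
theorem wachspress_convex_combination (n : ℕ) [NeZero n] (hn : 3 ≤ n)
    (v : ZMod n → ℝ × ℝ) (x : ℝ × ℝ)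
    (hA : ∀ i : ZMod n, 0 < signedArea x (v i) (v (i + 1)))
    (hB : ∀ i : ZMod n, 0 < signedArea (v (i - 1)) (v i) (v (i + 1))) :
    (0 < ∑ i : ZMod n, signedArea (v (i - 1)) (v i) (v (i + 1)) /
        (signedArea x (v (i - 1)) (v i) * signedArea x (v i) (v (i + 1)))) ∧
    (∑ i : ZMod n, signedArea (v (i - 1)) (v i) (v (i + 1)) /
        (signedArea x (v (i - 1)) (v i) * signedArea x (v i) (v (i + 1)))) • x
      = ∑ i : ZMod n, (signedArea (v (i - 1)) (v i) (v (i + 1)) /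
          (signedArea x (v (i - 1)) (v i) * signedArea x (v i) (v (i + 1)))) • v i := by
  have hA' (i : ZMod n) : 0 < signedArea x (v (i - 1)) (v i) := by
    simpa using hA (i - 1)
  refine ⟨Finset.sum_pos (fun i _ => div_pos (hB i) (mul_pos (hA' i) (hA i)))
    Finset.univ_nonempty, ?_⟩
  symm
  rw [← sub_eq_zero, Finset.sum_smul, ← Finset.sum_sub_distrib]
  simp_rw [← smul_sub, fun i => wachspress_weight_smul_sub x (v (i - 1)) (v i) (v (i + 1))
    (hA' i).ne' (hA i).ne']
  rw [Finset.sum_sub_distrib, sub_eq_zero]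
  exact Fintype.sum_equiv (Equiv.subRight 1) _ _ fun i => by simp
end

section
/- Let X₁ and X₂ be nonempty finite types, V₁ and V₂ real vector spaces, and f₁ : X₁ → V₁, f₂ : X₂ → V₂ valuation functions. For a point α ∈ V_i, let R_i(α) be the set of probability weights p : X_i → ℝ with p x ≥ 0 for all x, ∑_x p x = 1, and ∑_x p x • f_i x = α, and define the entropy H_i(α) := sSup { −∑_x p x · Real.log (p x) | p ∈ R_i(α) } (with the convention 0·log 0 = 0). Let f : X₁ × X₂ → V₁ × V₂ be the product valuation f(x₁,x₂) = (f₁ x₁, f₂ x₂), with entropy H defined analogously. Then for all α₁ ∈ V₁ and α₂ ∈ V₂ such that R₁(α₁) and R₂(α₂) are nonempty, H((α₁,α₂)) = H₁(α₁) + H₂(α₂). -/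
/-- The set of probability weight systems representing `α` as a convex
combination of the values of the valuation function `f`. -/
def probWeights {X V : Type*} [Fintype X] [AddCommGroup V] [Module ℝ V]
    (f : X → V) (α : V) : Set (X → ℝ) :=
  {p | (∀ x, 0 ≤ p x) ∧ ∑ x, p x = 1 ∧ ∑ x, p x • f x = α}

/-- The entropy of a point `α` with respect to a valuation function `f`:
the supremum of `−∑ p_x log p_x` over all representing probability weights
(with the convention `0·log 0 = 0`, consistent with `Real.log 0 = 0`). -/
noncomputable def pointEntropy {X V : Type*} [Fintype X] [AddCommGroup V] [Module ℝ V]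
    (f : X → V) (α : V) : ℝ :=
  sSup ((fun p : X → ℝ => -∑ x, p x * Real.log (p x)) '' probWeights f α)

/-- The pointwise form of Gibbs' inequality. -/
lemma neg_mul_log_le_of_dominated {r q : ℝ} (hr : 0 ≤ r) (hq : 0 ≤ q) (h : q = 0 → r = 0) :
    -(r * Real.log r) ≤ -(r * Real.log q) + (q - r) := by
  rcases hr.eq_or_lt with rfl | hr
  · simpa using hq
  have hq' : 0 < q := hq.lt_of_ne fun h0 => hr.ne' (h h0.symm)
  have hlog := Real.log_le_sub_one_of_pos (div_pos hq' hr)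
  rw [Real.log_div hq'.ne' hr.ne'] at hlog
  have hmul := mul_le_mul_of_nonneg_left hlog hr.le
  have hdiv : r * (q / r - 1) = q - r := by field_simp
  linarith

lemma bddAbove_entropy_probWeights {X V : Type*} [Fintype X] [AddCommGroup V] [Module ℝ V]
    (f : X → V) (α : V) :
    BddAbove ((fun p : X → ℝ => -∑ x, p x * Real.log (p x)) '' probWeights f α) := by
  refine ⟨∑ _x : X, 1, ?_⟩
  rintro _ ⟨p, ⟨hp, -, -⟩, rfl⟩
  simp only [← Finset.sum_neg_distrib]
  refine Finset.sum_le_sum fun x _ => ?_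
  linarith [Real.self_sub_one_le_mul_log (hp x), hp x]

section Product

variable {X₁ X₂ : Type*} [Fintype X₁] [Fintype X₂]

/-- Shannon entropy is additive on product weights. -/
lemma entropy_prod {p : X₁ → ℝ} {q : X₂ → ℝ} (hp : ∑ x, p x = 1) (hq : ∑ y, q y = 1) :
    -∑ z : X₁ × X₂, p z.1 * q z.2 * Real.log (p z.1 * q z.2)
      = -∑ x, p x * Real.log (p x) + -∑ y, q y * Real.log (q y) := by
  have hsplit : ∀ x y, p x * q y * Real.log (p x * q y)
      = p x * Real.log (p x) * q y + p x * (q y * Real.log (q y)) := by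
    intro x y
    have := Real.negMulLog_mul (p x) (q y)
    simp only [Real.negMulLog] at this
    linarith
  simp only [Fintype.sum_prod_type, hsplit, Finset.sum_add_distrib, ← Finset.mul_sum,
    ← Finset.sum_mul, hp, hq]
  ring

/-- Shannon entropy is subadditive: it is at most the sum of the entropies of the marginals. -/
lemma entropy_le_entropy_marginals {r : X₁ × X₂ → ℝ} (hr : ∀ z, 0 ≤ r z) (hr1 : ∑ z, r z = 1) :
    -∑ z, r z * Real.log (r z)
      ≤ -∑ x, (∑ y, r (x, y)) * Real.log (∑ y, r (x, y))
        + -∑ y, (∑ x, r (x, y)) * Real.log (∑ x, r (x, y)) := by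
  set a : X₁ → ℝ := fun x => ∑ y, r (x, y) with ha
  set b : X₂ → ℝ := fun y => ∑ x, r (x, y) with hb
  have hra : ∀ x y, r (x, y) ≤ a x := fun x y =>
    Finset.single_le_sum (f := fun y => r (x, y)) (fun _ _ => hr _) (Finset.mem_univ y)
  have hrb : ∀ x y, r (x, y) ≤ b y := fun x y =>
    Finset.single_le_sum (f := fun x => r (x, y)) (fun _ _ => hr _) (Finset.mem_univ x)
  have ha0 : ∀ x, 0 ≤ a x := fun x => Finset.sum_nonneg fun _ _ => hr _
  have hb0 : ∀ y, 0 ≤ b y := fun y => Finset.sum_nonneg fun _ _ => hr _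
  have ha1 : ∑ x, a x = 1 := by rw [← hr1, Fintype.sum_prod_type]
  have hb1 : ∑ y, b y = 1 := by rw [← hr1, Fintype.sum_prod_type_right]
  have hpt : ∀ x y, -(r (x, y) * Real.log (r (x, y)))
      ≤ -(r (x, y) * Real.log (a x)) + -(r (x, y) * Real.log (b y))
        + (a x * b y - r (x, y)) := by
    intro x y
    have hzero : a x * b y = 0 → r (x, y) = 0 := by
      intro h
      rcases mul_eq_zero.1 h with h | h
      · exact le_antisymm (h ▸ hra x y) (hr _)
      · exact le_antisymm (h ▸ hrb x y) (hr _)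
    have key := neg_mul_log_le_of_dominated (hr (x, y)) (mul_nonneg (ha0 x) (hb0 y)) hzero
    by_cases h : a x * b y = 0
    · simp [hzero h, h]
    · rw [Real.log_mul (left_ne_zero_of_mul h) (right_ne_zero_of_mul h)] at key
      linarith
  have hsum := Finset.sum_le_sum fun x (_ : x ∈ Finset.univ) =>
    Finset.sum_le_sum fun y (_ : y ∈ Finset.univ) => hpt x y
  have hA : ∑ x, ∑ y, r (x, y) * Real.log (a x) = ∑ x, a x * Real.log (a x) := by
    simp only [← Finset.sum_mul, ha]
  have hB : ∑ x, ∑ y, r (x, y) * Real.log (b y) = ∑ y, b y * Real.log (b y) := by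
    rw [Finset.sum_comm]
    simp only [← Finset.sum_mul, hb]
  have hQ : ∑ x, ∑ y, a x * b y = 1 := by
    simp only [← Finset.mul_sum, hb1, mul_one, ha1]
  have hR : ∑ x, ∑ y, r (x, y) = 1 := ha1
  simp only [Finset.sum_add_distrib, Finset.sum_sub_distrib, Finset.sum_neg_distrib,
    hA, hB, hQ, hR] at hsum
  rw [Fintype.sum_prod_type]
  linarith

variable {V₁ V₂ : Type*} [AddCommGroup V₁] [Module ℝ V₁] [AddCommGroup V₂] [Module ℝ V₂]
  {f₁ : X₁ → V₁} {f₂ : X₂ → V₂} {α₁ : V₁} {α₂ : V₂}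

lemma prod_mem_probWeights {p : X₁ → ℝ} {q : X₂ → ℝ}
    (hp : p ∈ probWeights f₁ α₁) (hq : q ∈ probWeights f₂ α₂) :
    (fun z : X₁ × X₂ => p z.1 * q z.2)
      ∈ probWeights (fun x : X₁ × X₂ => (f₁ x.1, f₂ x.2)) (α₁, α₂) := by
  obtain ⟨hp0, hp1, hpα⟩ := hp
  obtain ⟨hq0, hq1, hqα⟩ := hq
  refine ⟨fun z => mul_nonneg (hp0 _) (hq0 _), ?_, Prod.ext ?_ ?_⟩
  · simp only [Fintype.sum_prod_type, ← Finset.mul_sum, hp1, hq1, mul_one]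
  · simp only [Prod.fst_sum, Prod.smul_fst, Fintype.sum_prod_type, ← Finset.sum_smul,
      ← Finset.mul_sum, hq1, mul_one, hpα]
  · simp only [Prod.snd_sum, Prod.smul_snd, Fintype.sum_prod_type_right, ← Finset.sum_smul,
      ← Finset.sum_mul, hp1, one_mul, hqα]

lemma fst_marginal_mem_probWeights {r : X₁ × X₂ → ℝ}
    (hr : r ∈ probWeights (fun x : X₁ × X₂ => (f₁ x.1, f₂ x.2)) (α₁, α₂)) :
    (fun x => ∑ y, r (x, y)) ∈ probWeights f₁ α₁ := by
  obtain ⟨hr0, hr1, hrα⟩ := hr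
  refine ⟨fun x => Finset.sum_nonneg fun _ _ => hr0 _, ?_, ?_⟩
  · rw [← hr1, Fintype.sum_prod_type]
  · simpa only [Prod.fst_sum, Prod.smul_fst, Fintype.sum_prod_type, Finset.sum_smul]
      using congrArg Prod.fst hrα

lemma snd_marginal_mem_probWeights {r : X₁ × X₂ → ℝ}
    (hr : r ∈ probWeights (fun x : X₁ × X₂ => (f₁ x.1, f₂ x.2)) (α₁, α₂)) :
    (fun y => ∑ x, r (x, y)) ∈ probWeights f₂ α₂ := by
  obtain ⟨hr0, hr1, hrα⟩ := hr
  refine ⟨fun y => Finset.sum_nonneg fun _ _ => hr0 _, ?_, ?_⟩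
  · rw [← hr1, Fintype.sum_prod_type_right]
  · simpa only [Prod.snd_sum, Prod.smul_snd, Fintype.sum_prod_type_right, Finset.sum_smul]
      using congrArg Prod.snd hrα

end Product

/-- Additivity of entropy for an independent combination of systems. -/
theorem entropy_additive {X₁ X₂ : Type*} [Fintype X₁] [Fintype X₂]
    [Nonempty X₁] [Nonempty X₂]
    {V₁ V₂ : Type*} [AddCommGroup V₁] [Module ℝ V₁] [AddCommGroup V₂] [Module ℝ V₂]
    (f₁ : X₁ → V₁) (f₂ : X₂ → V₂) (α₁ : V₁) (α₂ : V₂)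
    (h₁ : (probWeights f₁ α₁).Nonempty) (h₂ : (probWeights f₂ α₂).Nonempty) :
    pointEntropy (fun x : X₁ × X₂ => (f₁ x.1, f₂ x.2)) (α₁, α₂)
      = pointEntropy f₁ α₁ + pointEntropy f₂ α₂ := by
  obtain ⟨p₀, hp₀⟩ := h₁
  obtain ⟨q₀, hq₀⟩ := h₂
  unfold pointEntropy
  refine le_antisymm ?_ ?_
  · refine csSup_le ⟨_, Set.mem_image_of_mem _ (prod_mem_probWeights hp₀ hq₀)⟩ ?_
    rintro _ ⟨r, hr, rfl⟩
    exact (entropy_le_entropy_marginals hr.1 hr.2.1).trans <| add_le_add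
      (le_csSup (bddAbove_entropy_probWeights f₁ α₁)
        ⟨_, fst_marginal_mem_probWeights hr, rfl⟩)
      (le_csSup (bddAbove_entropy_probWeights f₂ α₂)
        ⟨_, snd_marginal_mem_probWeights hr, rfl⟩)
  · rw [← le_sub_iff_add_le]
    refine csSup_le ⟨_, Set.mem_image_of_mem _ hp₀⟩ ?_
    rintro _ ⟨p, hp, rfl⟩
    rw [le_sub_comm]
    refine csSup_le ⟨_, Set.mem_image_of_mem _ hq₀⟩ ?_
    rintro _ ⟨q, hq, rfl⟩
    rw [le_sub_iff_add_le, add_comm]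
    exact (entropy_prod hp.2.1 hq.2.1).symm.le.trans <|
      le_csSup (bddAbove_entropy_probWeights _ _) ⟨_, prod_mem_probWeights hp hq, rfl⟩
end
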